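/- For every n ≥ 1, the binomial-Stirling-Eulerian polynomial is symmetric in x and y: Ã_n(x,y|α) = Ã_n(y,x|α) as an identity of polynomials in ℤ[x,y,α]; explicitly, ∑_{σ∈PRW_{n+1}} x^{des(σ)} y^{asc(σ)} α^{LRmin(σ)+RLmin(σ)−2} = ∑_{σ∈PRW_{n+1}} y^{des(σ)} x^{asc(σ)} α^{LRmin(σ)+RLmin(σ)−2}. -/

import Mathlib

/-- The letter at (1-based) position `i` of the word `w`, with the boundary
convention that positions `0` and `> w.length` carry the value `w.length + 1`
(playing the role of `+∞` for a permutation word of `{1,…,n}`). -/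
def wB (w : List ℕ) (i : ℕ) : ℕ :=
  if 1 ≤ i ∧ i ≤ w.length then w.getD (i - 1) 0 else w.length + 1

/-- The one-line word `σ_1 ⋯ σ_n` (with letters in `{1,…,n}`) of a permutation of `Fin n`. -/
def word {n : ℕ} (σ : Equiv.Perm (Fin n)) : List ℕ := List.ofFn (fun i => (σ i : ℕ) + 1)

/-- Number of descents: indices `i ∈ {1,…,n-1}` with `σ_i > σ_{i+1}`. -/
def desW (w : List ℕ) : ℕ :=
  ((Finset.Icc 1 (w.length - 1)).filter (fun i => wB w (i + 1) < wB w i)).card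

/-- Number of ascents: indices `i ∈ {1,…,n-1}` with `σ_i < σ_{i+1}`. -/
def ascW (w : List ℕ) : ℕ :=
  ((Finset.Icc 1 (w.length - 1)).filter (fun i => wB w i < wB w (i + 1))).card

/-- Position `i` is a double ascent: `σ_{i-1} < σ_i < σ_{i+1}` (boundary `σ_0 = σ_{n+1} = +∞`). -/
abbrev isDAat (w : List ℕ) (i : ℕ) : Prop := wB w (i - 1) < wB w i ∧ wB w i < wB w (i + 1)

/-- Position `i` is a double descent: `σ_{i-1} > σ_i > σ_{i+1}`. -/
abbrev isDDat (w : List ℕ) (i : ℕ) : Prop := wB w i < wB w (i - 1) ∧ wB w (i + 1) < wB w i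

/-- Position `i` is a peak: `σ_{i-1} < σ_i > σ_{i+1}`. -/
abbrev isPkat (w : List ℕ) (i : ℕ) : Prop := wB w (i - 1) < wB w i ∧ wB w (i + 1) < wB w i

/-- Position `i` is a valley: `σ_{i-1} > σ_i < σ_{i+1}`. -/
abbrev isVlat (w : List ℕ) (i : ℕ) : Prop := wB w i < wB w (i - 1) ∧ wB w i < wB w (i + 1)

/-- Position `i` holds a left-to-right minimum: `σ_j > σ_i` for all `j < i`. -/
abbrev isLRat (w : List ℕ) (i : ℕ) : Prop := ∀ j ∈ Finset.Icc 1 (i - 1), wB w i < wB w j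

/-- Position `i` holds a right-to-left minimum: `σ_j > σ_i` for all `j > i`. -/
abbrev isRLat (w : List ℕ) (i : ℕ) : Prop := ∀ j ∈ Finset.Icc (i + 1) w.length, wB w i < wB w j

/-- `da`, the number of double ascents. -/
def daW (w : List ℕ) : ℕ := ((Finset.Icc 1 w.length).filter (isDAat w)).card

/-- `dd`, the number of double descents. -/
def ddW (w : List ℕ) : ℕ := ((Finset.Icc 1 w.length).filter (isDDat w)).card

/-- `M`, the number of peaks. -/
def pkW (w : List ℕ) : ℕ := ((Finset.Icc 1 w.length).filter (isPkat w)).card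

/-- `LRmin`, the number of left-to-right minima. -/
def lrminW (w : List ℕ) : ℕ := ((Finset.Icc 1 w.length).filter (isLRat w)).card

/-- `RLmin`, the number of right-to-left minima. -/
def rlminW (w : List ℕ) : ℕ := ((Finset.Icc 1 w.length).filter (isRLat w)).card

/-- The word belongs to `PRW`: if it has an ascent, the first ascent occurs at the letter `1`. -/
abbrev isPRW (w : List ℕ) : Prop :=
  ∀ i ∈ Finset.Icc 1 (w.length - 1), wB w i < wB w (i + 1) →
    (∀ j ∈ Finset.Icc 1 (i - 1), ¬ wB w j < wB w (j + 1)) → wB w i = 1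

/-- The set `PRW_n` of permutations whose first ascent (if any) appears at the letter `1`. -/
def PRW (n : ℕ) : Finset (Equiv.Perm (Fin n)) :=
  Finset.univ.filter (fun σ => isPRW (word σ))

section

open MvPolynomial

/-- The sum of the partial derivatives with respect to `x = X 0` and `y = X 1`. -/
noncomputable def diagDeriv (m : ℕ) :
    Derivation ℤ (MvPolynomial (Fin (m + 3)) ℤ) (MvPolynomial (Fin (m + 3)) ℤ) :=
  pderiv 0 + pderiv 1

/-- The weight of a word `l` that follows the letter `a`. -/
noncomputable def tailWeight : ℕ → List ℕ → MvPolynomial (Fin 4) ℤ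
  | _, [] => 1
  | a, b :: l => (if a < b then X 1 else X 0) * (if ∀ c ∈ l, b < c then X 2 else 1) *
      tailWeight b l

/-- The weight of a word: letters of a decreasing prefix before the letter `1` are marked by `X 3`,
and words with an ascent before the letter `1` have weight `0`. -/
noncomputable def prefixWeight : List ℕ → MvPolynomial (Fin 4) ℤ
  | [] => 0
  | b :: l => if b = 1 then tailWeight 1 l else
      if l.headD b < b then X 3 * prefixWeight l else 0

theorem sum_tailWeight_permutations'Aux (M : ℕ) (l : List ℕ) (a : ℕ) (ha : a < M)
    (hl : ∀ b ∈ l, b < M) :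
    ((l.permutations'Aux M).map (tailWeight a)).sum =
      X 2 * X 1 * tailWeight a l + X 0 * X 1 * diagDeriv 1 (tailWeight a l) := by
  induction l generalizing a with
  | nil => simp [tailWeight, ha, mul_comm]
  | cons b l ih =>
    have hb : b < M := hl b (by simp)
    have h : ∀ l' ∈ l.permutations'Aux M, tailWeight a (b :: l') =
        ((if a < b then X 1 else X 0) * (if ∀ c ∈ l, b < c then X 2 else 1)) *
          tailWeight b l' := by
      intro l' hl'
      have hp : l'.Perm (M :: l) := List.mem_permutations'.1 <|
        List.mem_flatMap.2 ⟨l, List.mem_permutations'.2 (List.Perm.refl l), hl'⟩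
      have : (∀ c ∈ l', b < c) ↔ ∀ c ∈ l, b < c := by
        simp [hp.mem_iff, hb]
      simp only [tailWeight, this]
    rw [List.permutations'Aux, List.map_cons, List.sum_cons, List.map_map,
      List.map_congr_left (f := tailWeight a ∘ List.cons b) h, List.sum_map_mul_left,
      ih b hb fun c hc => hl c (by simp [hc])]
    have h1 : ¬ ∀ c ∈ b :: l, M < c := fun h => by have := h b (by simp); omega
    simp only [tailWeight, ha, if_true, if_neg h1, if_neg hb.not_gt]
    split_ifs <;> simp [diagDeriv] <;> ring

theorem sum_prefixWeight_permutations'Aux (M : ℕ) (l : List ℕ) (hM : 1 < M)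
    (h1 : 1 ∈ l) (hl : ∀ b ∈ l, b < M) :
    ((l.permutations'Aux M).map prefixWeight).sum =
      (X 3 + X 2 * X 1) * prefixWeight l + X 0 * X 1 * diagDeriv 1 (prefixWeight l) := by
  induction l with
  | nil => simp at h1
  | cons b l ih =>
    have hb : b < M := hl b (by simp)
    have hMb : prefixWeight (M :: b :: l) = X 3 * prefixWeight (b :: l) := by
      rw [prefixWeight]; simp [hb, hM.ne']
    rw [List.permutations'Aux, List.map_cons, List.sum_cons, List.map_map, hMb]
    by_cases hb1 : b = 1
    · subst hb1
      have h : prefixWeight ∘ List.cons 1 = tailWeight 1 := by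
        funext l'; simp [prefixWeight]
      rw [h, sum_tailWeight_permutations'Aux M l 1 hM fun c hc => hl c (by simp [hc])]
      simp [prefixWeight]; ring
    · obtain ⟨c, l, rfl⟩ : ∃ c l', l = c :: l' := by
        cases l with
        | nil => simp at h1; omega
        | cons c l => exact ⟨c, l, rfl⟩
      have hc : c < M := hl c (by simp)
      have hMc : prefixWeight (M :: c :: l) = X 3 * prefixWeight (c :: l) := by
        rw [prefixWeight]; simp [hc, hM.ne']
      have ih := ih (by simpa [Ne.symm hb1] using h1) fun d hd => hl d (by simp at hd ⊢; tauto)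
      rw [List.permutations'Aux, List.map_cons, List.sum_cons, List.map_map, hMc] at ih
      have h : prefixWeight ∘ List.cons b ∘ List.cons c =
          fun l' => (if c < b then X 3 else 0) * prefixWeight (c :: l') := by
        funext l'
        simp only [Function.comp]
        rw [prefixWeight]; simp [hb1]
      have hMb0 : prefixWeight (b :: M :: c :: l) = 0 := by
        rw [prefixWeight]; simp [hb1, hb.le]
      have hbc : prefixWeight (b :: c :: l) =
          (if c < b then X 3 else 0) * prefixWeight (c :: l) := by
        rw [prefixWeight]; simp [hb1]
      rw [List.permutations'Aux, List.map_cons, List.sum_cons, List.map_map, Function.comp_apply,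
        hMb0, Function.comp_assoc, h, List.sum_map_mul_left, hbc]
      have ih' : (List.map (fun l' => prefixWeight (c :: l')) (l.permutations'Aux M)).sum =
        X 2 * X 1 * prefixWeight (c :: l) + X 0 * X 1 * diagDeriv 1 (prefixWeight (c :: l)) := by
        simp only [Function.comp_def] at ih
        linear_combination ih
      rw [ih']
      split_ifs <;> simp [diagDeriv]; ring

/-- The word `n + 1, n, …, 1`. -/
def decreasingWord : ℕ → List ℕ
  | 0 => [1]
  | n + 1 => (n + 2) :: decreasingWord n

/-- The generating function of `prefixWeight` over all permutations of `1, …, n + 1`. -/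
noncomputable def prefixPoly (n : ℕ) : MvPolynomial (Fin 4) ℤ :=
  ((decreasingWord n).permutations'.map prefixWeight).sum

theorem length_decreasingWord (n : ℕ) : (decreasingWord n).length = n + 1 := by
  induction n with
  | zero => rfl
  | succ n ih => simp [decreasingWord, ih]

theorem mem_decreasingWord {n a : ℕ} : a ∈ decreasingWord n ↔ 1 ≤ a ∧ a ≤ n + 1 := by
  induction n with
  | zero => simp [decreasingWord]; omega
  | succ n ih => simp [decreasingWord, ih]; omega

theorem nodup_decreasingWord (n : ℕ) : (decreasingWord n).Nodup := by
  induction n with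
  | zero => simp [decreasingWord]
  | succ n ih => simp [decreasingWord, ih, mem_decreasingWord]

theorem prefixPoly_zero : prefixPoly 0 = 1 := by
  simp [prefixPoly, decreasingWord, prefixWeight, tailWeight]

theorem prefixPoly_succ (n : ℕ) : prefixPoly (n + 1) =
    (X 3 + X 2 * X 1) * prefixPoly n + X 0 * X 1 * diagDeriv 1 (prefixPoly n) := by
  have h : ∀ w ∈ (decreasingWord n).permutations',
      ((w.permutations'Aux (n + 2)).map prefixWeight).sum =
      (X 3 + X 2 * X 1) * prefixWeight w + X 0 * X 1 * diagDeriv 1 (prefixWeight w) := by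
    intro w hw
    have hw := List.mem_permutations'.1 hw
    refine sum_prefixWeight_permutations'Aux (n + 2) w (by omega) ?_ ?_
    · simp [hw.mem_iff, mem_decreasingWord]
    · intro b hb
      have := mem_decreasingWord.1 (hw.mem_iff.1 hb)
      omega
  rw [prefixPoly, decreasingWord, List.permutations', List.map_flatMap, List.flatMap,
    List.sum_flatten, List.map_map]
  rw [show (List.sum ∘ fun w : List ℕ => (w.permutations'Aux (n + 2)).map prefixWeight) =
    fun w => ((w.permutations'Aux (n + 2)).map prefixWeight).sum from rfl,
    List.map_congr_left h, List.sum_map_add, List.sum_map_mul_left, List.sum_map_mul_left,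
    prefixPoly, map_list_sum, List.map_map]
  rfl

theorem pderiv_diagDeriv (p : MvPolynomial (Fin 4) ℤ) :
    pderiv 3 (diagDeriv 1 p) = diagDeriv 1 (pderiv 3 p) := by
  have h : ⁅pderiv (R := ℤ) (3 : Fin 4), diagDeriv 1⁆ = 0 :=
    MvPolynomial.derivation_ext fun i => by
      fin_cases i <;> simp [Derivation.commutator_apply, diagDeriv]
  have := congrArg (fun d => d p) h
  simpa [Derivation.commutator_apply, sub_eq_zero] using this

theorem pderiv_prefixPoly_succ (n : ℕ) :
    pderiv 3 (prefixPoly (n + 1)) = (n + 1) * prefixPoly n := by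
  induction n with
  | zero => simp [prefixPoly_succ, prefixPoly_zero]
  | succ n ih =>
    rw [prefixPoly_succ (n + 1)]
    have hD1 : diagDeriv 1 (((n : MvPolynomial (Fin 4) ℤ) + 1) * prefixPoly n) =
      ((n : MvPolynomial (Fin 4) ℤ) + 1) * diagDeriv 1 (prefixPoly n) := by
      simp
    have h1 := prefixPoly_succ n
    simp only [Derivation.leibniz, map_add, pderiv_diagDeriv, ih, hD1, smul_eq_mul, pderiv_X_self,
      pderiv_X_of_ne (show (0 : Fin 4) ≠ 3 by decide),
      pderiv_X_of_ne (show (1 : Fin 4) ≠ 3 by decide),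
      pderiv_X_of_ne (show (2 : Fin 4) ≠ 3 by decide)]
    push_cast
    linear_combination (-(n : MvPolynomial (Fin 4) ℤ) - 1) * h1

/-- The substitution of `α x` for the fourth variable. -/
noncomputable def substPrefix : MvPolynomial (Fin 4) ℤ →ₐ[ℤ] MvPolynomial (Fin 3) ℤ :=
  aeval ![X 0, X 1, X 2, X 2 * X 0]

theorem diagDeriv_substPrefix (p : MvPolynomial (Fin 4) ℤ) :
    diagDeriv 0 (substPrefix p) =
      substPrefix (diagDeriv 1 p) + X 2 * substPrefix (pderiv 3 p) := by
  induction p using MvPolynomial.induction_on with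
  | C a => simp [diagDeriv, substPrefix]
  | add p q hp hq => simp only [map_add, hp, hq]; ring
  | mul_X p i hp =>
    simp only [map_mul, Derivation.leibniz, hp, smul_eq_mul, map_add]
    fin_cases i <;> simp [diagDeriv, substPrefix] <;> ring

theorem rename_swap_diagDeriv (p : MvPolynomial (Fin 3) ℤ) :
    rename (Equiv.swap (0 : Fin 3) 1) (diagDeriv 0 p) =
      diagDeriv 0 (rename (Equiv.swap (0 : Fin 3) 1) p) := by
  induction p using MvPolynomial.induction_on with
  | C a => simp [diagDeriv]
  | add p q hp hq => simp only [map_add, hp, hq]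
  | mul_X p i hp =>
    simp only [map_mul, Derivation.leibniz, hp, smul_eq_mul, map_add]
    fin_cases i <;> simp [diagDeriv, Equiv.swap_apply_of_ne_of_ne]

theorem substPrefix_prefixPoly_succ (n : ℕ) : substPrefix (prefixPoly (n + 1)) =
    X 2 * (X 0 + X 1) * substPrefix (prefixPoly n) +
      X 0 * X 1 * (diagDeriv 0 (substPrefix (prefixPoly n)) -
        X 2 * substPrefix (pderiv 3 (prefixPoly n))) := by
  rw [diagDeriv_substPrefix, prefixPoly_succ]
  have h : ∀ i, substPrefix (X i) = ![X 0, X 1, X 2, X 2 * X 0] i := fun i => aeval_X _ i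
  simp only [map_add, map_mul, h]
  simp only [Matrix.cons_val]
  ring

theorem rename_swap_substPrefix_prefixPoly (n : ℕ) :
    rename (Equiv.swap (0 : Fin 3) 1) (substPrefix (prefixPoly n)) =
      substPrefix (prefixPoly n) := by
  have h2 : Equiv.swap (0 : Fin 3) 1 2 = 2 := by decide
  induction n using Nat.strong_induction_on with
  | _ n ih =>
    cases n with
    | zero => simp [prefixPoly_zero]
    | succ n =>
      have hd : rename (Equiv.swap (0 : Fin 3) 1) (substPrefix (pderiv 3 (prefixPoly n))) =
          substPrefix (pderiv 3 (prefixPoly n)) := by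
        cases n with
        | zero => simp [prefixPoly_zero]
        | succ n =>
          rw [pderiv_prefixPoly_succ]
          simp [ih n (by omega)]
      rw [substPrefix_prefixPoly_succ]
      simp only [map_add, map_mul, map_sub, rename_swap_diagDeriv, ih n (by omega), hd, rename_X,
        Equiv.swap_apply_left, Equiv.swap_apply_right, h2]
      ring

theorem card_filter_Icc_one_succ (p : ℕ → Prop) [DecidablePred p] (k : ℕ) :
    ((Finset.Icc 1 (k + 1)).filter p).card =
      (if p 1 then 1 else 0) + ((Finset.Icc 1 k).filter fun i => p (i + 1)).card := by
  simp only [Finset.card_filter, ← Finset.Ico_add_one_right_eq_Icc, Finset.sum_Ico_eq_sum_range]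
  rw [show k + 1 + 1 - 1 = k + 1 by omega, Finset.sum_range_succ', Nat.add_comm]
  simp [Nat.add_comm, Nat.add_left_comm]

theorem forall_Icc_add_one (p : ℕ → Prop) (k m : ℕ) :
    (∀ j ∈ Finset.Icc (m + 1) (k + 1), p j) ↔ ∀ j ∈ Finset.Icc m k, p (j + 1) := by
  simp only [Finset.mem_Icc]
  refine ⟨fun h j hj => h (j + 1) (by omega), fun h j hj => ?_⟩
  obtain ⟨i, rfl⟩ : ∃ i, j = i + 1 := ⟨j - 1, by omega⟩
  exact h i (by omega)

theorem wB_cons_one (a : ℕ) (w : List ℕ) : wB (a :: w) 1 = a := by simp [wB]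

theorem wB_cons_succ (a : ℕ) (w : List ℕ) {i : ℕ} (h1 : 1 ≤ i) (h2 : i ≤ w.length) :
    wB (a :: w) (i + 1) = wB w i := by
  obtain ⟨i, rfl⟩ : ∃ j, i = j + 1 := ⟨i - 1, by omega⟩
  simp [wB, h2, Nat.lt_of_succ_le h2]

theorem forall_wB_iff (p : ℕ → Prop) (w : List ℕ) :
    (∀ j ∈ Finset.Icc 1 w.length, p (wB w j)) ↔ ∀ c ∈ w, p c := by
  rw [List.forall_mem_iff_getElem]
  simp only [Finset.mem_Icc]
  refine ⟨fun h i hi => ?_, fun h j hj => ?_⟩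
  · have := h (i + 1) (by omega)
    simpa [wB, Nat.succ_le_of_lt hi, hi] using this
  · have := h (j - 1) (by omega)
    rw [wB, if_pos hj, List.getD_eq_getElem _ _ (by omega)]
    exact this

theorem desW_cons_cons (a b : ℕ) (l : List ℕ) :
    desW (a :: b :: l) = (if b < a then 1 else 0) + desW (b :: l) := by
  simp only [desW, List.length_cons, Nat.add_sub_cancel]
  rw [card_filter_Icc_one_succ, wB_cons_one, wB_cons_succ _ _ (by simp) (by simp), wB_cons_one]
  congr 2
  refine Finset.filter_congr fun i hi => ?_
  rw [Finset.mem_Icc] at hi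
  rw [wB_cons_succ a (b :: l) (i := i) (by omega) (by simp; omega),
    wB_cons_succ a (b :: l) (i := i + 1) (by omega) (by simp; omega)]

theorem ascW_cons_cons (a b : ℕ) (l : List ℕ) :
    ascW (a :: b :: l) = (if a < b then 1 else 0) + ascW (b :: l) := by
  simp only [ascW, List.length_cons, Nat.add_sub_cancel]
  rw [card_filter_Icc_one_succ, wB_cons_one, wB_cons_succ _ _ (by simp) (by simp), wB_cons_one]
  congr 2
  refine Finset.filter_congr fun i hi => ?_
  rw [Finset.mem_Icc] at hi
  rw [wB_cons_succ a (b :: l) (i := i) (by omega) (by simp; omega),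
    wB_cons_succ a (b :: l) (i := i + 1) (by omega) (by simp; omega)]

theorem rlminW_cons (b : ℕ) (l : List ℕ) :
    rlminW (b :: l) = (if ∀ c ∈ l, b < c then 1 else 0) + rlminW l := by
  simp only [rlminW, List.length_cons]
  rw [card_filter_Icc_one_succ]
  have h : isRLat (b :: l) 1 ↔ ∀ c ∈ l, b < c := by
    rw [← forall_wB_iff, isRLat, List.length_cons, forall_Icc_add_one, wB_cons_one]
    refine forall₂_congr fun i hi => ?_
    rw [Finset.mem_Icc] at hi
    rw [wB_cons_succ _ _ (by omega) (by omega)]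
  simp only [h]
  congr 2
  refine Finset.filter_congr fun i hi => ?_
  rw [Finset.mem_Icc] at hi
  rw [isRLat, isRLat, List.length_cons, forall_Icc_add_one, wB_cons_succ _ _ (by omega) (by omega)]
  refine forall₂_congr fun j hj => ?_
  rw [Finset.mem_Icc] at hj
  rw [wB_cons_succ _ _ (by omega) (by omega)]

theorem isLRat_one (w : List ℕ) : isLRat w 1 := fun j hj => by simp at hj

theorem isLRat_cons_succ (b : ℕ) (w : List ℕ) {i : ℕ} (h1 : 1 ≤ i) (h2 : i ≤ w.length) :
    isLRat (b :: w) (i + 1) ↔ wB w i < b ∧ isLRat w i := by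
  simp only [isLRat, Finset.mem_Icc, wB_cons_succ b w h1 h2]
  constructor
  · intro h
    refine ⟨wB_cons_one b w ▸ h 1 (by omega), fun j hj => ?_⟩
    have := h (j + 1) (by omega)
    rwa [wB_cons_succ _ _ (by omega) (by omega)] at this
  · rintro ⟨hb, h⟩ j hj
    obtain rfl | hj1 := eq_or_ne j 1
    · rwa [wB_cons_one]
    · obtain ⟨j, rfl⟩ : ∃ i, j = i + 1 := ⟨j - 1, by omega⟩
      rw [wB_cons_succ _ _ (by omega) (by omega)]
      exact h j (by omega)

theorem lrminW_cons_of_forall_le {a : ℕ} {l : List ℕ} (h : ∀ c ∈ l, a ≤ c) :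
    lrminW (a :: l) = 1 := by
  simp only [lrminW, List.length_cons]
  rw [card_filter_Icc_one_succ, if_pos (isLRat_one _), Finset.filter_false_of_mem,
    Finset.card_empty]
  intro i hi
  rw [Finset.mem_Icc] at hi
  rw [isLRat_cons_succ _ _ (by omega) (by omega)]
  have := (forall_wB_iff (a ≤ ·) l).2 h i (by simpa using hi)
  omega

theorem lrminW_cons_cons {b c : ℕ} (l : List ℕ) (h : c < b) :
    lrminW (b :: c :: l) = 1 + lrminW (c :: l) := by
  rw [lrminW, List.length_cons, lrminW, card_filter_Icc_one_succ, if_pos (isLRat_one _)]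
  congr 2
  refine Finset.filter_congr fun i hi => ?_
  rw [Finset.mem_Icc] at hi
  rw [isLRat_cons_succ _ _ (by omega) (by omega)]
  refine and_iff_right_of_imp fun hi' => ?_
  obtain rfl | hi1 := eq_or_ne i 1
  · rwa [wB_cons_one]
  · have := hi' 1 (by simp; omega)
    rw [wB_cons_one] at this
    omega

theorem isPRW_cons_one {l : List ℕ} (h : ∀ c ∈ l, 1 < c) : isPRW (1 :: l) := by
  intro i hi _ hj
  simp only [Finset.mem_Icc, List.length_cons, Nat.add_sub_cancel] at hi
  obtain rfl | hi1 := eq_or_ne i 1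
  · exact wB_cons_one 1 l
  · refine absurd ?_ (hj 1 (by simp; omega))
    rw [wB_cons_one, wB_cons_succ _ _ le_rfl (by omega)]
    exact (forall_wB_iff (1 < ·) l).2 h 1 (by simp; omega)

theorem isPRW_cons_cons {b c : ℕ} (l : List ℕ) (hb : b ≠ 1) (hbc : b ≠ c) :
    isPRW (b :: c :: l) ↔ c < b ∧ isPRW (c :: l) := by
  have h1 := wB_cons_one b (c :: l)
  have h2 : wB (b :: c :: l) 2 = c := by
    rw [wB_cons_succ _ _ le_rfl (by simp), wB_cons_one]
  have hs : ∀ i, 1 ≤ i → i ≤ l.length + 1 → wB (b :: c :: l) (i + 1) = wB (c :: l) i :=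
    fun i hi hi' => wB_cons_succ _ _ hi hi'
  simp only [isPRW, Finset.mem_Icc, List.length_cons, Nat.add_sub_cancel]
  constructor
  · intro h
    have hcb : c < b := by
      by_contra hcb
      refine hb (h1.symm.trans (h 1 (by omega) ?_ fun j hj => by omega))
      rw [h1, h2]; omega
    refine ⟨hcb, fun i hi ha hj => ?_⟩
    rw [← hs i (by omega) (by omega)]
    refine h (i + 1) (by omega) ?_ fun j hj' => ?_
    · rwa [hs _ (by omega) (by omega), hs _ (by omega) (by omega)]
    · obtain rfl | hj1 := eq_or_ne j 1
      · rw [h1, h2]; omega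
      · obtain ⟨j, rfl⟩ : ∃ i, j = i + 1 := ⟨j - 1, by omega⟩
        rw [hs _ (by omega) (by omega), hs _ (by omega) (by omega)]
        exact hj j (by omega)
  · rintro ⟨hcb, h⟩ i hi ha hj
    obtain rfl | hi1 := eq_or_ne i 1
    · rw [h1, h2] at ha; omega
    · obtain ⟨i, rfl⟩ : ∃ j, i = j + 1 := ⟨i - 1, by omega⟩
      rw [hs _ (by omega) (by omega), hs _ (by omega) (by omega)] at ha
      rw [hs _ (by omega) (by omega)]
      refine h i (by omega) ha fun j hj' => ?_
      have := hj (j + 1) (by omega)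
      rwa [hs _ (by omega) (by omega), hs _ (by omega) (by omega)] at this

theorem substPrefix_tailWeight (a : ℕ) (l : List ℕ) (h : (a :: l).Nodup) :
    substPrefix (tailWeight a l) =
      X 0 ^ desW (a :: l) * X 1 ^ ascW (a :: l) * X 2 ^ rlminW l := by
  induction l generalizing a with
  | nil => simp [tailWeight, desW, ascW, rlminW]
  | cons b l ih =>
    have hab : a ≠ b := by rintro rfl; simp at h
    rw [tailWeight, map_mul, map_mul, ih b h.of_cons, desW_cons_cons, ascW_cons_cons, rlminW_cons]
    rcases hab.lt_or_gt with hab | hab <;>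
      simp only [hab, hab.not_gt, if_true, if_false] <;> split_ifs <;>
      simp [substPrefix] <;> ring

theorem substPrefix_prefixWeight (w : List ℕ) (h : w.Nodup) (h1 : 1 ∈ w) (h0 : ∀ c ∈ w, 1 ≤ c) :
    (isPRW w → 2 ≤ lrminW w + rlminW w) ∧
    substPrefix (prefixWeight w) = if isPRW w then
      X 0 ^ desW w * X 1 ^ ascW w * X 2 ^ (lrminW w + rlminW w - 2) else 0 := by
  induction w with
  | nil => simp at h1
  | cons b l ih =>
    rw [prefixWeight]
    obtain rfl | hb := eq_or_ne b 1
    · have hl : ∀ c ∈ l, 1 < c := fun c hc =>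
        lt_of_le_of_ne (h0 c (by simp [hc])) fun e => by simp [e, hc] at h
      rw [if_pos rfl, if_pos (isPRW_cons_one hl), substPrefix_tailWeight 1 l h,
        lrminW_cons_of_forall_le fun c hc => (hl c hc).le, rlminW_cons, if_pos hl]
      exact ⟨fun _ => by omega, by congr 2; omega⟩
    · obtain ⟨c, l, rfl⟩ : ∃ c l', l = c :: l' := by
        cases l with
        | nil => simp at h1; omega
        | cons c l => exact ⟨c, l, rfl⟩
      have h1' : 1 ∈ c :: l := by simpa [hb.symm] using h1
      have hbc : b ≠ c := by rintro rfl; simp at h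
      obtain ⟨ih1, ih2⟩ := ih h.of_cons h1' fun d hd => h0 d (List.mem_cons_of_mem _ hd)
      have hn : ¬ ∀ d ∈ c :: l, b < d := fun hd => by
        have := hd 1 h1'
        have := h0 b (by simp)
        omega
      have hiff := isPRW_cons_cons l hb hbc
      rw [if_neg hb, List.headD_cons, rlminW_cons, if_neg hn, desW_cons_cons, ascW_cons_cons]
      by_cases hp : isPRW (b :: c :: l)
      · obtain ⟨hcb, hp'⟩ := hiff.1 hp
        have hle := ih1 hp'
        rw [if_pos hp, lrminW_cons_cons l hcb, if_pos hcb, if_pos hcb, if_neg hcb.not_gt, map_mul,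
          ih2, if_pos hp', show 1 + lrminW (c :: l) + (0 + rlminW (c :: l)) - 2 =
            1 + (lrminW (c :: l) + rlminW (c :: l) - 2) by omega]
        refine ⟨fun _ => by omega, ?_⟩
        simp only [substPrefix, aeval_X, Matrix.cons_val]
        ring
      · refine ⟨fun h => absurd h hp, ?_⟩
        rw [if_neg hp]
        split_ifs with hcb
        · rw [map_mul, ih2, if_neg fun h => hp (hiff.2 ⟨hcb, h⟩), mul_zero]
        · exact map_zero _

theorem sum_perm_word {A : Type*} [AddCommMonoid A] (n : ℕ) (f : List ℕ → A) :
    ∑ σ : Equiv.Perm (Fin (n + 1)), f (word σ) =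
      ((decreasingWord n).permutations'.map f).sum := by
  have hinj : Function.Injective (word (n := n + 1)) := by
    intro σ τ h
    ext i
    simpa using congrFun (List.ofFn_injective h) i
  have hnd : (decreasingWord n).permutations'.Nodup :=
    (List.permutations_perm_permutations' _).nodup
      (List.nodup_permutations _ (nodup_decreasingWord n))
  have himage : Finset.univ.image (word (n := n + 1)) =
      (decreasingWord n).permutations'.toFinset := by
    refine Finset.eq_of_subset_of_card_le ?_ ?_
    · intro w hw
      obtain ⟨σ, -, rfl⟩ := Finset.mem_image.1 hw
      rw [List.mem_toFinset, List.mem_permutations',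
        List.perm_ext_iff_of_nodup _ (nodup_decreasingWord n)]
      · intro a
        rw [mem_decreasingWord, word, List.mem_ofFn]
        constructor
        · rintro ⟨i, rfl⟩
          have := (σ i).isLt
          omega
        · intro ha
          refine ⟨σ.symm ⟨a - 1, by omega⟩, ?_⟩
          simp; omega
      · rw [word, List.nodup_ofFn]
        intro i j hij
        simpa [Fin.val_inj] using hij
    · rw [List.toFinset_card_of_nodup hnd, Finset.card_image_of_injective _ hinj, Finset.card_univ,
        Fintype.card_perm, Fintype.card_fin,
        ← (List.permutations_perm_permutations' _).length_eq, List.length_permutations]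
      rw [length_decreasingWord]
  rw [← List.sum_toFinset f hnd, ← himage, Finset.sum_image hinj.injOn]

theorem sum_PRW_eq (n : ℕ) :
    ∑ σ ∈ PRW (n + 1), (X 0 : MvPolynomial (Fin 3) ℤ) ^ desW (word σ) * X 1 ^ ascW (word σ) *
        X 2 ^ (lrminW (word σ) + rlminW (word σ) - 2) = substPrefix (prefixPoly n) := by
  rw [PRW, Finset.sum_filter, sum_perm_word n fun w => if isPRW w then
    (X 0 : MvPolynomial (Fin 3) ℤ) ^ desW w * X 1 ^ ascW w * X 2 ^ (lrminW w + rlminW w - 2) else 0,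
    prefixPoly, map_list_sum, List.map_map]
  refine congrArg _ (List.map_congr_left fun w hw => ?_)
  have hw := List.mem_permutations'.1 hw
  refine ((substPrefix_prefixWeight w (hw.nodup_iff.2 (nodup_decreasingWord n)) ?_ ?_).2).symm
  · simp [hw.mem_iff, mem_decreasingWord]
  · intro c hc
    exact (mem_decreasingWord.1 (hw.mem_iff.1 hc)).1

end

open MvPolynomial in
/-- the binomial-Stirling-Eulerian polynomial `Ã_n(x,y|α)` is symmetric
in `x` and `y`, as polynomials in `ℤ[x,y,α]` (with `x = X 0`, `y = X 1`, `α = X 2`). -/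
theorem binomialStirlingEulerian_symm (n : ℕ) (hn : 1 ≤ n) :
    ∑ σ ∈ PRW (n + 1), (X 0 : MvPolynomial (Fin 3) ℤ) ^ desW (word σ) * X 1 ^ ascW (word σ) *
        X 2 ^ (lrminW (word σ) + rlminW (word σ) - 2)
      = ∑ σ ∈ PRW (n + 1), (X 1 : MvPolynomial (Fin 3) ℤ) ^ desW (word σ) *
          X 0 ^ ascW (word σ) * X 2 ^ (lrminW (word σ) + rlminW (word σ) - 2) := by
  have hswap := congrArg (rename (Equiv.swap (0 : Fin 3) 1)) (sum_PRW_eq n)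
  rw [rename_swap_substPrefix_prefixPoly, ← sum_PRW_eq n] at hswap
  rw [← hswap]
  have h2 : Equiv.swap (0 : Fin 3) 1 2 = 2 := by decide
  simp [h2]
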